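/- Let Ω, U, λ, u be as in the setting, and assume the pure-Neumann invariance property. Then the set W is open in ℝ². -/

import Mathlib

open Metric Set Filter Topology MeasureTheory

noncomputable section

abbrev E2 := EuclideanSpace ℝ (Fin 2)

/-- The Laplacian of `u`: the sum of the two pure second partial derivatives. -/
def lap (u : E2 → ℝ) (z : E2) : ℝ :=
  ∑ i : Fin 2, iteratedFDeriv ℝ 2 u z (fun _ => EuclideanSpace.single i 1)

/-- The set `W` of points of `Ω` whose full gradient-descent trajectory stays in
`closure Ω`, converging to a local minimum point of `u` as `t → +∞` and to a local
maximum point of `u` as `t → -∞`. -/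
def Wset (Ω : Set E2) (u : E2 → ℝ) : Set E2 :=
  {z ∈ Ω | ∃ γ : ℝ → E2, γ 0 = z ∧
    (∀ t : ℝ, HasDerivAt γ (-(gradient u (γ t))) t) ∧
    (∀ t : ℝ, γ t ∈ closure Ω) ∧
    (∃ q ∈ closure Ω, IsLocalMin u q ∧ Tendsto γ atTop (𝓝 q)) ∧
    (∃ p ∈ closure Ω, IsLocalMax u p ∧ Tendsto γ atBot (𝓝 p))}


theorem ode_unique {X : E2 → E2} {K : NNReal} (hX : LipschitzWith K X) {a b : ℝ}
    {f g : ℝ → E2} {t₀ : ℝ} (ht : t₀ ∈ Ioo a b)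
    (hf : ∀ t ∈ Ioo a b, HasDerivAt f (X (f t)) t)
    (hg : ∀ t ∈ Ioo a b, HasDerivAt g (X (g t)) t) (h : f t₀ = g t₀) :
    EqOn f g (Ioo a b) :=
  ODE_solution_unique_of_mem_Ioo (v := fun _ => X) (s := fun _ => univ) (K := K)
    (fun _ _ => hX.lipschitzOnWith) ht (fun t h => ⟨hf t h, trivial⟩)
    (fun t h => ⟨hg t h, trivial⟩) h

theorem ode_global_exists {X : E2 → E2} {K : NNReal} (hX : LipschitzWith K X) {M : NNReal}
    (hM : ∀ x, ‖X x‖ ≤ M) (z : E2) :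
    ∃ γ : ℝ → E2, γ 0 = z ∧ ∀ t, HasDerivAt γ (X (γ t)) t := by
  have key : ∀ n : ℕ, ∃ α : ℝ → E2, α 0 = z ∧
      ∀ t ∈ Ioo (-(n : ℝ)) n, HasDerivAt α (X (α t)) t := by
    intro n
    have h0 : (0 : ℝ) ∈ Icc (-(n : ℝ)) n := by constructor <;> simp
    have hpl : IsPicardLindelof (fun _ => X) (⟨0, h0⟩ : Icc (-(n : ℝ)) n) z (M * n) 0 M K :=
      { lipschitzOnWith := fun _ _ => hX.lipschitzOnWith
        continuousOn := fun _ _ => continuousOn_const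
        norm_le := fun _ _ x _ => hM x
        mul_max_le := by simp }
    obtain ⟨α, h1, h2⟩ := hpl.exists_eq_forall_mem_Icc_hasDerivWithinAt₀
    exact ⟨α, h1, fun t ht => (h2 t (Ioo_subset_Icc_self ht)).hasDerivAt (Icc_mem_nhds ht.1 ht.2)⟩
  choose α hα0 hα using key
  have agree : ∀ n m : ℕ, n ≤ m → ∀ t ∈ Ioo (-(n : ℝ)) n, α n t = α m t := by
    intro n m hnm t ht
    have hc : (n : ℝ) ≤ m := by exact_mod_cast hnm
    have hn : (0 : ℝ) < n := by have := ht.1; have := ht.2; linarith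
    exact ode_unique hX (t₀ := 0) (a := -(n : ℝ)) (b := n) ⟨by linarith, hn⟩ (hα n)
      (fun t ht => hα m t ⟨by linarith [ht.1], by linarith [ht.2]⟩) (by rw [hα0, hα0]) ht
  have habs : ∀ t : ℝ, t ∈ Ioo (-((⌈|t|⌉₊ + 1 : ℕ) : ℝ)) ((⌈|t|⌉₊ + 1 : ℕ) : ℝ) := by
    intro t
    have := Nat.le_ceil |t|
    push_cast
    exact abs_lt.1 (by linarith)
  refine ⟨fun t => α (⌈|t|⌉₊ + 1) t, hα0 _, fun t₀ => ?_⟩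
  set N := ⌈|t₀|⌉₊ + 3 with hN
  have hev : (fun t => α (⌈|t|⌉₊ + 1) t) =ᶠ[𝓝 t₀] α N := by
    filter_upwards [Metric.ball_mem_nhds t₀ one_pos] with t ht
    refine agree _ _ ?_ t (habs t)
    have h1 : |t| ≤ |t₀| + 1 := by
      rw [Metric.mem_ball, Real.dist_eq] at ht
      have := abs_sub_abs_le_abs_sub t t₀
      linarith
    have h2 : ⌈|t|⌉₊ ≤ ⌈|t₀|⌉₊ + 1 := by
      apply Nat.ceil_le.2
      push_cast
      linarith [Nat.le_ceil |t₀|]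
    omega
  have h3 : t₀ ∈ Ioo (-(N : ℝ)) N := by
    have := Nat.le_ceil |t₀|
    refine abs_lt.1 ?_
    rw [hN]; push_cast; linarith
  have := (hα N t₀ h3).congr_of_eventuallyEq hev
  rwa [← hev.eq_of_nhds] at this

theorem ode_dist_fwd {X : E2 → E2} {K : NNReal} (hX : LipschitzWith K X)
    {f g : ℝ → E2} (hf : ∀ t, HasDerivAt f (X (f t)) t) (hg : ∀ t, HasDerivAt g (X (g t)) t)
    {T t : ℝ} (h0 : 0 ≤ t) (hT : t ≤ T) :
    dist (f t) (g t) ≤ dist (f 0) (g 0) * Real.exp (K * T) := by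
  have h := dist_le_of_trajectories_ODE (v := fun _ => X) (K := K) (a := 0) (b := T)
    (fun _ => hX) (f := f) (g := g)
    (fun t _ => (hf t).continuousAt.continuousWithinAt) (fun t _ => (hf t).hasDerivWithinAt)
    (fun t _ => (hg t).continuousAt.continuousWithinAt) (fun t _ => (hg t).hasDerivWithinAt)
    le_rfl t ⟨h0, hT⟩
  refine h.trans ?_
  gcongr
  linarith

theorem ode_reverse {X : E2 → E2} {f : ℝ → E2} (hf : ∀ t, HasDerivAt f (X (f t)) t) :
    ∀ t, HasDerivAt (fun s => f (-s)) (-X (f (-t))) t := by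
  intro t
  have := (hf (-t)).scomp t (hasDerivAt_neg t)
  rw [neg_one_smul] at this
  exact this

theorem ode_dist {X : E2 → E2} {K : NNReal} (hX : LipschitzWith K X)
    {f g : ℝ → E2} (hf : ∀ t, HasDerivAt f (X (f t)) t) (hg : ∀ t, HasDerivAt g (X (g t)) t)
    {T t : ℝ} (ht : |t| ≤ T) :
    dist (f t) (g t) ≤ dist (f 0) (g 0) * Real.exp (K * T) := by
  rcases le_total 0 t with h | h
  · exact ode_dist_fwd hX hf hg h ((le_abs_self t).trans ht)
  · have hXn : LipschitzWith K (fun x => -X x) := hX.neg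
    have := ode_dist_fwd hXn (ode_reverse hf) (ode_reverse hg) (T := T) (t := -t) (by linarith)
      ((neg_le_abs t).trans ht)
    simpa using this

theorem grad_zero_of_isLocalMin {u : E2 → ℝ} {z : E2} (h : IsLocalMin u z) : gradient u z = 0 := by
  simp [gradient, h.fderiv_eq_zero]

theorem hasDerivAt_along {u : E2 → ℝ} {γ : ℝ → E2} {t : ℝ} (hd : DifferentiableAt ℝ u (γ t))
    (hγ : HasDerivAt γ (-gradient u (γ t)) t) :
    HasDerivAt (fun s => u (γ s)) (-‖gradient u (γ t)‖ ^ 2) t := by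
  have h1 := hd.hasGradientAt.hasFDerivAt.comp_hasDerivAt t hγ
  have h2 : (InnerProductSpace.toDual ℝ E2 (gradient u (γ t))) (-gradient u (γ t))
      = -‖gradient u (γ t)‖ ^ 2 := by
    rw [InnerProductSpace.toDual_apply_apply, inner_neg_right, real_inner_self_eq_norm_sq]
  rw [h2] at h1
  exact h1

theorem root_ineq {f G C : ℝ} {n : ℕ} (hn : 1 ≤ n) (hf : 0 < f) (hG : 0 ≤ G) (hC : 0 < C)
    (h : f ^ (n - 1) ≤ C * G ^ n) :
    G ≤ (n * C ^ (1 / (n : ℝ))) * ((1 / (n : ℝ)) * f ^ (1 / (n : ℝ) - 1) * G ^ 2) := by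
  have hn0 : (0 : ℝ) < n := by exact_mod_cast hn
  have hCn : (C ^ (1 / (n : ℝ))) ^ n = C := by
    rw [one_div]; exact Real.rpow_inv_natCast_pow hC.le (by omega)
  have hfn : (f ^ (1 - 1 / (n : ℝ))) ^ n = f ^ (n - 1) := by
    rw [← Real.rpow_natCast, ← Real.rpow_mul hf.le, ← Real.rpow_natCast]
    congr 1
    rw [Nat.cast_sub hn]; field_simp; simp
  have h1 : f ^ (1 - 1 / (n : ℝ)) ≤ C ^ (1 / (n : ℝ)) * G := by
    refine le_of_pow_le_pow_left₀ (n := n) (by omega) (by positivity) ?_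
    rw [hfn, mul_pow, hCn]; exact h
  have h2 : f ^ (1 / (n : ℝ) - 1) * f ^ (1 - 1 / (n : ℝ)) = 1 := by
    rw [← Real.rpow_add hf]; simp
  have h3 : 0 < f ^ (1 / (n : ℝ) - 1) := Real.rpow_pos_of_pos hf _
  have h4 : 1 ≤ f ^ (1 / (n : ℝ) - 1) * (C ^ (1 / (n : ℝ)) * G) := by
    have := mul_le_mul_of_nonneg_left h1 h3.le
    rwa [h2] at this
  calc G = 1 * G := (one_mul G).symm
    _ ≤ (f ^ (1 / (n : ℝ) - 1) * (C ^ (1 / (n : ℝ)) * G)) * G := by gcongr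
    _ = _ := by field_simp

theorem length_bound {u : E2 → ℝ} {q : E2} {ε : ℝ}
    (hd : ∀ z ∈ ball q ε, DifferentiableAt ℝ u z)
    {n : ℕ} (hn : 1 ≤ n) {C : ℝ} (hC : 0 < C)
    (hL : ∀ z ∈ ball q ε, (u z - u q) ^ (n - 1) ≤ C * ‖gradient u z‖ ^ n)
    {γ : ℝ → E2} {a b : ℝ} (hab : a ≤ b) (hin : ∀ t ∈ Icc a b, γ t ∈ ball q ε)
    (hγ : ∀ t ∈ Icc a b, HasDerivAt γ (-gradient u (γ t)) t)
    (hpos : ∀ t ∈ Icc a b, 0 < u (γ t) - u q) :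
    ‖γ b - γ a‖ ≤ (n * C ^ (1 / (n : ℝ))) * (u (γ a) - u q) ^ (1 / (n : ℝ))
      - (n * C ^ (1 / (n : ℝ))) * (u (γ b) - u q) ^ (1 / (n : ℝ)) := by
  set A : ℝ := n * C ^ (1 / (n : ℝ)) with hA
  have hB : ∀ t ∈ Icc a b, HasDerivAt
      (fun s => A * (u (γ a) - u q) ^ (1 / (n : ℝ)) - A * (u (γ s) - u q) ^ (1 / (n : ℝ)))
      (A * ((1 / (n : ℝ)) * (u (γ t) - u q) ^ (1 / (n : ℝ) - 1) * ‖gradient u (γ t)‖ ^ 2)) t := by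
    intro t ht
    have h1 := (hasDerivAt_along (hd _ (hin t ht)) (hγ t ht)).sub_const (u q)
    have h2 := h1.rpow_const (p := 1 / (n : ℝ)) (Or.inl (hpos t ht).ne')
    have h3 := (h2.const_mul A).const_sub (A * (u (γ a) - u q) ^ (1 / (n : ℝ)))
    refine h3.congr_deriv ?_
    ring
  have := image_norm_le_of_norm_deriv_right_le_deriv_boundary'
    (f := fun t => γ t - γ a) (f' := fun t => -gradient u (γ t)) (a := a) (b := b)
    (B := fun s => A * (u (γ a) - u q) ^ (1 / (n : ℝ)) - A * (u (γ s) - u q) ^ (1 / (n : ℝ)))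
    (B' := fun t =>
      A * ((1 / (n : ℝ)) * (u (γ t) - u q) ^ (1 / (n : ℝ) - 1) * ‖gradient u (γ t)‖ ^ 2))
    (fun t ht => ((hγ t ht).sub_const _).continuousAt.continuousWithinAt)
    (fun t ht => ((hγ t (Ico_subset_Icc_self ht)).sub_const _).hasDerivWithinAt)
    (by simp)
    (fun t ht => (hB t ht).continuousAt.continuousWithinAt)
    (fun t ht => (hB t (Ico_subset_Icc_self ht)).hasDerivWithinAt)
    (fun t ht => by
      have ht' := Ico_subset_Icc_self ht
      rw [norm_neg]
      exact root_ineq hn (hpos t ht') (norm_nonneg _) hC (hL _ (hin t ht')))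
    (right_mem_Icc.2 hab)
  exact this

theorem limit_equilibrium {X : E2 → E2} (hX : Continuous X) {γ : ℝ → E2}
    (hγ : ∀ t, HasDerivAt γ (X (γ t)) t) {p : E2} (hp : Tendsto γ atTop (𝓝 p)) : X p = 0 := by
  have hXp : Tendsto (fun t => X (γ t)) atTop (𝓝 (X p)) := (hX.tendsto p).comp hp
  have h1 : Tendsto (fun t => γ (t + 1) - γ t) atTop (𝓝 (p - p)) :=
    (hp.comp (tendsto_atTop_add_const_right _ 1 tendsto_id)).sub hp
  have h2 : Tendsto (fun t => γ (t + 1) - γ t) atTop (𝓝 (X p)) := by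
    rw [Metric.tendsto_nhds] at hXp ⊢
    intro e he
    obtain ⟨T, hT⟩ := eventually_atTop.1 (hXp (e / 2) (by linarith))
    filter_upwards [eventually_ge_atTop T] with t ht
    have := norm_image_sub_le_of_norm_deriv_right_le_segment
      (f := fun s => γ s - s • X p) (f' := fun s => X (γ s) - X p) (a := t) (b := t + 1)
      (C := e / 2)
      (fun s _ => ((hγ s).sub (by simpa using (hasDerivAt_id s).smul_const (X p))
        : HasDerivAt _ (X (γ s) - X p) s).continuousAt.continuousWithinAt)
      (fun s _ => ((hγ s).sub (by simpa using (hasDerivAt_id s).smul_const (X p))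
        : HasDerivAt _ (X (γ s) - X p) s).hasDerivWithinAt)
      (fun s hs => by
        have := hT s (ht.trans hs.1)
        rw [dist_eq_norm] at this
        exact this.le) (t + 1) (right_mem_Icc.2 (by linarith))
    rw [dist_eq_norm]
    have e1 : γ (t + 1) - γ t - X p = γ (t + 1) - (t + 1) • X p - (γ t - t • X p) := by
      rw [add_smul, one_smul]; abel
    rw [e1]
    linarith
  rw [sub_self] at h1
  exact tendsto_nhds_unique h2 h1

theorem stability {u : E2 → ℝ} {q : E2} {ε : ℝ} (hε : 0 < ε) {X : E2 → E2} {K : NNReal}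
    (hX : LipschitzWith K X) (hXu : ∀ z ∈ ball q ε, X z = -gradient u z)
    (hd : ∀ z ∈ ball q ε, DifferentiableAt ℝ u z) (hmin : ∀ z ∈ ball q ε, u q ≤ u z)
    {n : ℕ} (hn : 2 ≤ n) {C : ℝ} (hC : 0 < C)
    (hL : ∀ z ∈ ball q ε, (u z - u q) ^ (n - 1) ≤ C * ‖gradient u z‖ ^ n) :
    ∃ δ > 0, ∀ γ : ℝ → E2, (∀ t, HasDerivAt γ (X (γ t)) t) → ∀ T : ℝ, γ T ∈ ball q δ →
      (∀ t ≥ T, γ t ∈ ball q ε) ∧ ∃ p, IsLocalMin u p ∧ Tendsto γ atTop (𝓝 p) := by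
  set A : ℝ := n * C ^ (1 / (n : ℝ)) with hA
  have hn0 : (0 : ℝ) < n := by exact_mod_cast (by omega : 0 < n)
  have hA0 : 0 < A := by positivity
  -- a critical point in the ball is a local minimum
  have hcrit : ∀ z ∈ ball q ε, X z = 0 → IsLocalMin u z := by
    intro z hz h0
    have hg : gradient u z = 0 := by rw [hXu z hz] at h0; simpa using h0
    have h1 := hL z hz
    rw [hg, norm_zero, zero_pow (by omega), mul_zero] at h1
    have h2 : u z - u q = 0 := by
      have h3 : (0:ℝ) ≤ u z - u q := by linarith [hmin z hz]
      exact pow_eq_zero_iff (by omega) |>.1 (le_antisymm h1 (by positivity))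
    filter_upwards [isOpen_ball.mem_nhds hz] with w hw
    linarith [hmin w hw]
  -- choice of δ
  have hcont : ContinuousAt (fun z => A * (u z - u q) ^ (1 / (n : ℝ))) q := by
    have := (hd q (mem_ball_self hε)).continuousAt
    refine continuousAt_const.mul ((this.sub continuousAt_const).rpow_const (Or.inr ?_))
    positivity
  have hev : ∀ᶠ z in 𝓝 q, A * (u z - u q) ^ (1 / (n : ℝ)) < ε / 4 := by
    refine hcont.eventually_lt_const ?_
    show A * (u q - u q) ^ (1 / (n : ℝ)) < ε / 4
    rw [sub_self, Real.zero_rpow (by positivity)]; linarith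
  obtain ⟨δ', hδ', hδ⟩ := Metric.eventually_nhds_iff_ball.1 hev
  refine ⟨min δ' (ε / 4), by positivity, fun γ hγ T hT => ?_⟩
  have hT1 : γ T ∈ ball q δ' := ball_subset_ball (min_le_left _ _) hT
  have hT2 : dist (γ T) q < ε / 4 := lt_of_lt_of_le hT (min_le_right _ _)
  by_cases hc : ∃ t₀, X (γ t₀) = 0
  · obtain ⟨t₀, ht₀⟩ := hc
    have hconst : ∀ t, γ t = γ t₀ := by
      intro t
      exact ode_unique hX (a := min t t₀ - 1) (b := max t t₀ + 1) (t₀ := t₀)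
        ⟨by linarith [min_le_right t t₀], by linarith [le_max_right t t₀]⟩
        (fun s _ => hγ s) (g := fun _ => γ t₀)
        (fun s _ => by rw [ht₀]; exact hasDerivAt_const s _) rfl
        ⟨by linarith [min_le_left t t₀], by linarith [le_max_left t t₀]⟩
    have hin : γ t₀ ∈ ball q ε := by
      rw [← hconst T, mem_ball]; linarith
    refine ⟨fun t _ => by rw [hconst t]; exact hin, γ t₀, hcrit _ hin ht₀, ?_⟩
    rw [show γ = fun _ => γ t₀ from funext hconst]
    exact tendsto_const_nhds
  push Not at hc
  have hpos : ∀ t, γ t ∈ ball q ε → 0 < u (γ t) - u q := by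
    intro t ht
    rcases (hmin _ ht).lt_or_eq with h | h
    · linarith
    · exfalso
      apply hc t
      rw [hXu _ ht, grad_zero_of_isLocalMin, neg_zero]
      filter_upwards [isOpen_ball.mem_nhds ht] with w hw
      linarith [hmin w hw]
  have hγc : Continuous γ := continuous_iff_continuousAt.2 fun t => (hγ t).continuousAt
  have hlen : ∀ a b, a ≤ b → (∀ t ∈ Icc a b, γ t ∈ ball q ε) →
      ‖γ b - γ a‖ ≤ A * (u (γ a) - u q) ^ (1 / (n : ℝ)) - A * (u (γ b) - u q) ^ (1 / (n : ℝ)) := by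
    intro a b hab hin
    refine length_bound hd (by omega) hC hL hab hin (fun t ht => ?_) (fun t ht => hpos t (hin t ht))
    rw [← hXu _ (hin t ht)]; exact hγ t
  have hstay : ∀ t ≥ T, dist (γ t) q < ε / 2 := by
    by_contra! hcon
    obtain ⟨t₂, ht₂, hd₂⟩ := hcon
    set S := {t | T ≤ t ∧ ε / 2 ≤ dist (γ t) q} with hS
    have hScl : IsClosed S :=
      (isClosed_le continuous_const continuous_id).inter
        (isClosed_le continuous_const (hγc.dist continuous_const))
    have hSbdd : BddBelow S := ⟨T, fun t ht => ht.1⟩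
    have hmem := hScl.csInf_mem ⟨t₂, ht₂, hd₂⟩ hSbdd
    set t₁ := sInf S with ht₁
    have hlt : ∀ t, T ≤ t → t < t₁ → dist (γ t) q < ε / 2 := by
      intro t h1 h2
      by_contra! h3
      exact absurd (csInf_le hSbdd ⟨h1, h3⟩) (not_le.2 h2)
    have hTt : T < t₁ := by
      rcases hmem.1.lt_or_eq with h | h
      · exact h
      · have := hmem.2; rw [← h] at this; linarith
    have hle : dist (γ t₁) q ≤ ε / 2 := by
      refine le_of_tendsto (f := fun t => dist (γ t) q) (x := 𝓝[<] t₁) ?_ ?_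
      · exact ((hγc.dist continuous_const).tendsto t₁).mono_left nhdsWithin_le_nhds
      · filter_upwards [Ioo_mem_nhdsLT hTt] with t ht
        exact (hlt t ht.1.le ht.2).le
    have h5 := hlen T t₁ hTt.le (fun t ht => by
      rw [mem_ball]
      rcases ht.2.lt_or_eq with h | h
      · linarith [hlt t ht.1 h]
      · rw [h]; linarith)
    have h6 := hδ _ hT1
    have h7 : 0 ≤ A * (u (γ t₁) - u q) ^ (1 / (n : ℝ)) := by
      have := hpos t₁ (by rw [mem_ball]; linarith)
      positivity
    have h8 := hmem.2
    have h9 := dist_triangle (γ t₁) (γ T) q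
    rw [dist_eq_norm (γ t₁) (γ T)] at h9
    linarith
  have hin : ∀ t ≥ T, γ t ∈ ball q ε := fun t ht => by
    rw [mem_ball]; linarith [hstay t ht]
  refine ⟨hin, ?_⟩
  set φ : ℝ → ℝ := fun t => A * (u (γ t) - u q) ^ (1 / (n : ℝ)) with hφ
  have hφ0 : ∀ t ≥ T, 0 ≤ φ t := fun t ht => by
    have := hpos t (hin t ht)
    simp only [hφ]; positivity
  have hφlen : ∀ a b, T ≤ a → a ≤ b → ‖γ b - γ a‖ ≤ φ a - φ b := fun a b h1 h2 =>
    hlen a b h2 (fun t ht => hin t (h1.trans ht.1))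
  -- φ(max T t) is antitone and bounded below
  have hanti : Antitone fun t => φ (max T t) := by
    intro a b hab
    have := hφlen (max T a) (max T b) (le_max_left _ _) (max_le_max le_rfl hab)
    have h0 := norm_nonneg (γ (max T b) - γ (max T a))
    show φ (max T b) ≤ φ (max T a)
    linarith
  have hlim : Tendsto (fun t => φ (max T t)) atTop (𝓝 (⨅ t, φ (max T t))) :=
    tendsto_atTop_ciInf hanti ⟨0, by rintro _ ⟨t, rfl⟩; exact hφ0 _ (le_max_left _ _)⟩
  have hcau : Cauchy (map γ atTop) := by
    have hc1 := hlim.cauchy_map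
    rw [Metric.cauchy_iff] at hc1 ⊢
    refine ⟨inferInstance, fun e he => ?_⟩
    obtain ⟨s, hs, hs2⟩ := hc1.2 e he
    obtain ⟨N, hN⟩ := mem_atTop_sets.1 (mem_map.1 hs)
    refine ⟨γ '' Ici (max T N), image_mem_map (mem_atTop _), ?_⟩
    have main : ∀ a b, max T N ≤ a → a ≤ b → dist (γ a) (γ b) < e := by
      intro a b ha hab
      have hTa : T ≤ a := (le_max_left _ _).trans ha
      have hNa : N ≤ a := (le_max_right _ _).trans ha
      have h1 := hφlen a b hTa hab
      have h2 := hs2 _ (hN a hNa) _ (hN b (hNa.trans hab))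
      simp only [max_eq_right hTa, max_eq_right (hTa.trans hab), Real.dist_eq] at h2
      rw [dist_comm, dist_eq_norm]
      linarith [le_abs_self (φ a - φ b)]
    rintro _ ⟨a, ha, rfl⟩ _ ⟨b, hb, rfl⟩
    rcases le_total a b with h | h
    · exact main a b ha h
    · rw [dist_comm]; exact main b a hb h
  obtain ⟨p, hp⟩ := CompleteSpace.complete hcau
  have hp' : Tendsto γ atTop (𝓝 p) := hp
  have hpin : p ∈ ball q ε := by
    have : dist p q ≤ ε / 2 := by
      refine le_of_tendsto (hp'.dist tendsto_const_nhds) ?_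
      filter_upwards [eventually_ge_atTop T] with t ht
      exact (hstay t ht).le
    rw [mem_ball]; linarith
  exact ⟨p, hcrit p hpin (limit_equilibrium hX.continuous hγ hp'), hp'⟩

theorem second_deriv_nonneg {φ : ℝ → ℝ} (h : IsLocalMin φ 0) (hc : ContinuousAt φ 0) :
    0 ≤ deriv (deriv φ) 0 := by
  by_contra! hneg
  have hmax := isLocalMax_of_deriv_deriv_neg hneg h.deriv_eq_zero hc
  have hconst : φ =ᶠ[𝓝 0] fun _ => φ 0 := by
    filter_upwards [h, hmax] with t h1 h2
    exact le_antisymm h2 h1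
  have h1 : deriv φ =ᶠ[𝓝 0] deriv fun _ => φ 0 := hconst.deriv
  have h2 := h1.deriv_eq
  simp at h2
  linarith

theorem hasDerivAt_line (z e : E2) (t : ℝ) : HasDerivAt (fun t : ℝ => z + t • e) e t := by
  simpa using ((hasDerivAt_id t).smul_const e).const_add z

theorem tendsto_line (z e : E2) : Tendsto (fun t : ℝ => z + t • e) (𝓝 0) (𝓝 z) := by
  have : Continuous fun t : ℝ => z + t • e := by fun_prop
  simpa using this.tendsto 0

theorem deriv_line {u : E2 → ℝ} {z : E2} (hu : AnalyticAt ℝ u z) (e : E2) :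
    ∀ᶠ t in 𝓝 (0 : ℝ), HasDerivAt (fun t : ℝ => u (z + t • e)) (fderiv ℝ u (z + t • e) e) t := by
  filter_upwards [(tendsto_line z e).eventually hu.eventually_analyticAt] with t ht
  exact ht.differentiableAt.hasFDerivAt.comp_hasDerivAt t (hasDerivAt_line z e t)

theorem deriv2_line {u : E2 → ℝ} {z : E2} (hu : AnalyticAt ℝ u z) (e : E2) :
    HasDerivAt (deriv (fun t : ℝ => u (z + t • e)))
      (iteratedFDeriv ℝ 2 u z (fun _ => e)) 0 := by
  have h1 : deriv (fun t : ℝ => u (z + t • e)) =ᶠ[𝓝 0] fun t => fderiv ℝ u (z + t • e) e := by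
    filter_upwards [deriv_line hu e] with t ht
    exact ht.deriv
  have hg : HasFDerivAt (fun w => fderiv ℝ u w e)
      ((ContinuousLinearMap.apply ℝ ℝ e).comp (fderiv ℝ (fderiv ℝ u) z)) z :=
    (ContinuousLinearMap.apply ℝ ℝ e).hasFDerivAt.comp z hu.fderiv.differentiableAt.hasFDerivAt
  have h2 := hg.comp_hasDerivAt_of_eq (0 : ℝ) (hasDerivAt_line z e 0) (by simp)
  rw [iteratedFDeriv_two_apply]
  exact h2.congr_of_eventuallyEq h1

theorem barrier_line {a b : ℝ} (ha : 0 < a) :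
    (∀ᶠ t in 𝓝 (0 : ℝ), HasDerivAt (fun t : ℝ => (a + 2 * b * t + t ^ 2)⁻¹)
      (-(2 * b + 2 * t) / (a + 2 * b * t + t ^ 2) ^ 2) t) ∧
    HasDerivAt (deriv (fun t : ℝ => (a + 2 * b * t + t ^ 2)⁻¹)) ((-2 * a + 8 * b ^ 2) / a ^ 3) 0 := by
  have hev : ∀ᶠ t in 𝓝 (0 : ℝ), a + 2 * b * t + t ^ 2 ≠ 0 := by
    have : ContinuousAt (fun t : ℝ => a + 2 * b * t + t ^ 2) 0 := by fun_prop
    exact this.eventually_ne (by simpa using ha.ne')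
  have hpoly : ∀ t : ℝ, HasDerivAt (fun t : ℝ => a + 2 * b * t + t ^ 2) (2 * b + 2 * t) t := by
    intro t
    have h1 := (((hasDerivAt_id t).const_mul (2 * b)).const_add a).add ((hasDerivAt_id t).pow 2)
    refine h1.congr_deriv ?_
    simp
  have h1 : ∀ᶠ t in 𝓝 (0 : ℝ), HasDerivAt (fun t : ℝ => (a + 2 * b * t + t ^ 2)⁻¹)
      (-(2 * b + 2 * t) / (a + 2 * b * t + t ^ 2) ^ 2) t := by
    filter_upwards [hev] with t ht
    exact (hpoly t).inv ht
  refine ⟨h1, ?_⟩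
  have h2 : deriv (fun t : ℝ => (a + 2 * b * t + t ^ 2)⁻¹) =ᶠ[𝓝 0]
      fun t => -(2 * b + 2 * t) / (a + 2 * b * t + t ^ 2) ^ 2 := by
    filter_upwards [h1] with t ht
    exact ht.deriv
  have h3 : HasDerivAt (fun t : ℝ => -(2 * b + 2 * t)) (-2) 0 := by
    have := (((hasDerivAt_id (0:ℝ)).const_mul 2).const_add (2 * b)).neg
    refine this.congr_deriv ?_
    simp
  have h4 := h3.div ((hpoly 0).pow 2) (by simpa using ha.ne')
  refine (h4.congr_of_eventuallyEq h2).congr_deriv ?_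
  simp
  field_simp
  ring

theorem norm_line (z p : E2) (i : Fin 2) (t : ℝ) :
    ‖z + t • (EuclideanSpace.single i 1 : E2) - p‖ ^ 2
      = ‖z - p‖ ^ 2 + 2 * (z i - p i) * t + t ^ 2 := by
  fin_cases i <;> simp [EuclideanSpace.norm_sq_eq, Fin.sum_univ_two] <;> ring

theorem no_interior_min {u : E2 → ℝ} {z p : E2} (hu : AnalyticAt ℝ u z) (hl : lap u z ≤ 0)
    (hzp : z ≠ p) {κ c : ℝ} (hκ : 0 < κ)
    (hmin : IsLocalMin (fun w => u w - κ * ((‖w - p‖ ^ 2)⁻¹ - c)) z) : False := by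
  have ha : 0 < ‖z - p‖ ^ 2 := by
    have := norm_pos_iff.2 (sub_ne_zero.2 hzp); positivity
  have key : ∀ i : Fin 2, κ * ((-2 * ‖z - p‖ ^ 2 + 8 * (z i - p i) ^ 2) / (‖z - p‖ ^ 2) ^ 3)
      ≤ iteratedFDeriv ℝ 2 u z (fun _ => EuclideanSpace.single i 1) := by
    intro i
    set e : E2 := EuclideanSpace.single i 1
    obtain ⟨hb1, hb2⟩ := barrier_line (a := ‖z - p‖ ^ 2) (b := z i - p i) ha
    have hu1 := deriv_line hu e
    have hu2 := deriv2_line hu e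
    set φ : ℝ → ℝ := fun t =>
      u (z + t • e) - κ * ((‖z - p‖ ^ 2 + 2 * (z i - p i) * t + t ^ 2)⁻¹ - c) with hφ
    have hφmin : IsLocalMin φ 0 := by
      have h1 := (tendsto_line z e).eventually hmin
      filter_upwards [h1] with t ht
      have h0 := norm_line z p i t
      have h00 := norm_line z p i 0
      simp only [hφ]
      rw [← h0, ← h00]
      simpa using ht
    have hd1 : deriv φ =ᶠ[𝓝 0] fun t => deriv (fun t : ℝ => u (z + t • e)) t
        - κ * deriv (fun t : ℝ => (‖z - p‖ ^ 2 + 2 * (z i - p i) * t + t ^ 2)⁻¹) t := by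
      filter_upwards [hu1, hb1] with t h1 h2
      rw [h1.deriv, h2.deriv]
      exact (h1.sub ((h2.sub_const c).const_mul κ)).deriv
    have hd2 := (hu2.sub (hb2.const_mul κ)).congr_of_eventuallyEq hd1
    have hcont : ContinuousAt φ 0 := by
      exact (hu1.self_of_nhds.sub ((hb1.self_of_nhds.sub_const c).const_mul κ)).continuousAt
    have := second_deriv_nonneg hφmin hcont
    rw [hd2.deriv] at this
    linarith
  have h0 := key 0
  have h1 := key 1
  have hn : ‖z - p‖ ^ 2 = (z 0 - p 0) ^ 2 + (z 1 - p 1) ^ 2 := by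
    simp [EuclideanSpace.norm_sq_eq, Fin.sum_univ_two]
  have hsum : κ * ((-2 * ‖z - p‖ ^ 2 + 8 * (z 0 - p 0) ^ 2) / (‖z - p‖ ^ 2) ^ 3)
      + κ * ((-2 * ‖z - p‖ ^ 2 + 8 * (z 1 - p 1) ^ 2) / (‖z - p‖ ^ 2) ^ 3)
      = κ * (4 / (‖z - p‖ ^ 2) ^ 2) := by
    have : (z 1 - p 1) ^ 2 = ‖z - p‖ ^ 2 - (z 0 - p 0) ^ 2 := by linarith
    rw [this]
    generalize ‖z - p‖ ^ 2 = a at ha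
    field_simp
    ring
  have hpos : 0 < κ * (4 / (‖z - p‖ ^ 2) ^ 2) := by positivity
  rw [lap, Fin.sum_univ_two] at hl
  linarith

theorem hopf {u : E2 → ℝ} {q : E2} {ρ : ℝ}
    (hu : AnalyticOnNhd ℝ u (ball q ρ)) (h0 : ∀ z ∈ ball q ρ, 0 ≤ u z)
    (hl : ∀ z ∈ ball q ρ, lap u z ≤ 0) (hq : u q = 0) :
    ∀ p ∈ ball q (ρ / 4), u p = 0 := by
  intro p hp
  by_contra hup
  rw [mem_ball] at hp
  have hρ : 0 < ρ := by have := dist_nonneg (x := p) (y := q); linarith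
  have hin : ∀ z, dist z p ≤ dist p q → z ∈ ball q ρ := by
    intro z hz
    rw [mem_ball]
    have := dist_triangle z p q
    linarith
  have hcont : ContinuousOn u (closedBall p (dist p q)) := fun z hz =>
    (hu z (hin z hz)).continuousAt.continuousWithinAt
  have hZc : IsCompact (closedBall p (dist p q) ∩ u ⁻¹' {0}) := by
    refine (isCompact_closedBall p (dist p q)).of_isClosed_subset ?_ inter_subset_left
    exact hcont.preimage_isClosed_of_isClosed isClosed_closedBall isClosed_singleton
  obtain ⟨z₀, hz₀, hz₀min⟩ := hZc.exists_isMinOn ⟨q, by simp [dist_comm], hq⟩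
    (f := fun z => dist z p) (by fun_prop)
  set R := dist z₀ p with hR
  have hRq : R ≤ dist p q := hz₀.1
  have huz₀ : u z₀ = 0 := hz₀.2
  have hR0 : 0 < R := by
    rw [hR, dist_pos]; rintro rfl; exact hup huz₀
  have hinR : ∀ z, dist z p ≤ R → z ∈ ball q ρ := fun z hz => hin z (hz.trans hRq)
  have hpos : ∀ z, dist z p < R → 0 < u z := by
    intro z hz
    rcases (h0 z (hinR z hz.le)).lt_or_eq with h | h
    · exact h
    · exfalso
      have := hz₀min (a := z) ⟨hz.le.trans hRq, h.symm⟩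
      simp only [mem_ofPred_eq] at this
      linarith
  obtain ⟨c, hc, hcS⟩ : ∃ c > 0, ∀ z, dist z p = R / 2 → c ≤ u z := by
    by_cases hne : (sphere p (R / 2)).Nonempty
    · obtain ⟨w, hw, hwmin⟩ := (isCompact_sphere p (R / 2)).exists_isMinOn hne
        (f := u) (fun z hz => (hu z (hinR z (by rw [mem_sphere] at hz; linarith))).continuousAt.continuousWithinAt)
      rw [mem_sphere] at hw
      exact ⟨u w, hpos w (by linarith), fun z hz => hwmin (a := z) hz⟩
    · exact ⟨1, one_pos, fun z hz => absurd ⟨z, hz⟩ hne⟩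
  set κ := c * R ^ 2 / 3 with hκ
  have hκ0 : 0 < κ := by positivity
  set w : E2 → ℝ := fun z => u z - κ * ((‖z - p‖ ^ 2)⁻¹ - (R ^ 2)⁻¹) with hw
  have hAc : IsCompact {z | R / 2 ≤ dist z p ∧ dist z p ≤ R} := by
    refine (isCompact_closedBall p R).of_isClosed_subset ?_ (fun z hz => hz.2)
    exact (isClosed_le continuous_const (continuous_id.dist continuous_const)).inter
      (isClosed_le (continuous_id.dist continuous_const) continuous_const)
  have hwc : ContinuousOn w {z | R / 2 ≤ dist z p ∧ dist z p ≤ R} := by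
    intro z hz
    have h1 : ContinuousAt u z := (hu z (hinR z hz.2)).continuousAt
    have h2 : ‖z - p‖ ^ 2 ≠ 0 := by
      rw [← dist_eq_norm]; have : 0 < dist z p := by linarith [hz.1]
      positivity
    have h3 : ContinuousAt (fun z => ‖z - p‖ ^ 2) z := by fun_prop
    exact (h1.sub (continuousAt_const.mul ((h3.inv₀ h2).sub continuousAt_const))).continuousWithinAt
  obtain ⟨z₁, hz₁, hz₁min⟩ := hAc.exists_isMinOn ⟨z₀, by show R / 2 ≤ R; linarith, le_rfl⟩ hwc
  have hwz₁ : 0 ≤ w z₁ := by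
    rcases hz₁.1.lt_or_eq with h1 | h1
    · rcases hz₁.2.lt_or_eq with h2 | h2
      · exfalso
        refine no_interior_min (hu z₁ (hinR z₁ hz₁.2)) (hl z₁ (hinR z₁ hz₁.2)) (p := p) ?_ hκ0
          (c := (R ^ 2)⁻¹) ?_
        · rintro rfl; simp at h1; linarith
        · have ho : IsOpen {z | R / 2 < dist z p ∧ dist z p < R} :=
            (isOpen_lt continuous_const (continuous_id.dist continuous_const)).inter
              (isOpen_lt (continuous_id.dist continuous_const) continuous_const)
          filter_upwards [ho.mem_nhds ⟨h1, h2⟩] with z hz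
          exact hz₁min (a := z) ⟨hz.1.le, hz.2.le⟩
      · have := h0 z₁ (hinR z₁ hz₁.2)
        simp only [hw]
        rw [← dist_eq_norm, h2]
        simpa using this
    · have := hcS z₁ h1.symm
      simp only [hw]
      rw [← dist_eq_norm, ← h1]
      have : κ * (((R / 2) ^ 2)⁻¹ - (R ^ 2)⁻¹) = c := by
        rw [hκ]; field_simp; ring
      linarith
  have hge : ∀ z, R / 2 ≤ dist z p → dist z p ≤ R → κ * ((‖z - p‖ ^ 2)⁻¹ - (R ^ 2)⁻¹) ≤ u z := by
    intro z h1 h2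
    have : w z₁ ≤ w z := hz₁min (a := z) ⟨h1, h2⟩
    have : 0 ≤ w z := hwz₁.trans this
    simp only [hw] at this
    linarith
  -- contradiction at z₀
  have hz₀b : z₀ ∈ ball q ρ := hinR z₀ le_rfl
  have hz₀m : IsLocalMin u z₀ := by
    filter_upwards [isOpen_ball.mem_nhds hz₀b] with z hz
    rw [huz₀]; exact h0 z hz
  have hder := (deriv_line (hu z₀ hz₀b) (p - z₀)).self_of_nhds
  rw [zero_smul, add_zero, hz₀m.fderiv_eq_zero] at hder
  have hsl := hder.tendsto_slope_zero_right
  have hfin : 2 * κ / R ^ 2 ≤ 0 := by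
    refine ge_of_tendsto hsl ?_
    filter_upwards [Ioo_mem_nhdsGT (show (0 : ℝ) < 1 / 2 by norm_num)] with t ht
    have hdist : ‖z₀ + t • (p - z₀) - p‖ = (1 - t) * R := by
      have : z₀ + t • (p - z₀) - p = (1 - t) • (z₀ - p) := by module
      rw [this, norm_smul, Real.norm_of_nonneg (by linarith [ht.2]), hR, dist_eq_norm]
    have h1 := hge (z₀ + t • (p - z₀)) (by rw [dist_eq_norm, hdist]; nlinarith [ht.1, ht.2])
      (by rw [dist_eq_norm, hdist]; nlinarith [ht.1, ht.2])
    rw [hdist] at h1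
    have h2 : 2 * t ≤ ((1 - t) ^ 2)⁻¹ - 1 := by
      have ht1 := ht.1
      have ht2 := ht.2
      have : (0:ℝ) < (1 - t) ^ 2 := by have : 0 < 1 - t := by linarith
                                       positivity
      have h3 : 2 * t + 1 ≤ ((1 - t) ^ 2)⁻¹ := by
        rw [le_inv_comm₀ (by linarith) this, ← one_div, le_div_iff₀ (by linarith)]
        nlinarith [mul_pos ht1 ht1, mul_pos (mul_pos ht1 ht1) (show 0 < 3 - 2 * t by linarith)]
      linarith
    have h4 : (((1 - t) * R) ^ 2)⁻¹ - (R ^ 2)⁻¹ = (((1 - t) ^ 2)⁻¹ - 1) * (R ^ 2)⁻¹ := by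
      rw [mul_pow, mul_inv]; ring
    have h5 : κ * (2 * t * (R ^ 2)⁻¹) ≤ u (z₀ + t • (p - z₀)) := by
      refine le_trans ?_ h1
      rw [h4]
      gcongr
    simp only [zero_add, zero_smul, add_zero, huz₀, sub_zero, smul_eq_mul]
    rw [inv_mul_eq_div, le_div_iff₀ ht.1]
    calc 2 * κ / R ^ 2 * t = κ * (2 * t * (R ^ 2)⁻¹) := by ring
      _ ≤ _ := h5
  have : 0 < 2 * κ / R ^ 2 := by positivity
  linarith

theorem lap_pos_of_isLocalMin {U : Set E2} (hUo : IsOpen U) (hUconn : IsConnected U)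
    {lam : ℝ} (hlam : 0 < lam) {u : E2 → ℝ} (hu : AnalyticOnNhd ℝ u U)
    (hne : ∃ z ∈ U, u z ≠ 0) (heq : ∀ z ∈ U, lap u z + lam * u z = 0)
    {q : E2} (hq : q ∈ U) (hmin : IsLocalMin u q) : 0 < lap u q := by
  have hnn : 0 ≤ lap u q := by
    refine Finset.sum_nonneg fun i _ => ?_
    rw [← (deriv2_line (hu q hq) _).deriv]
    refine second_deriv_nonneg ?_ (deriv_line (hu q hq) _).self_of_nhds.continuousAt
    filter_upwards [(tendsto_line q _).eventually hmin] with t ht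
    simpa using ht
  rcases hnn.lt_or_eq with h | h
  · exact h
  exfalso
  have huq : u q = 0 := by
    have := heq q hq
    rw [← h, zero_add] at this
    exact (mul_eq_zero.1 this).resolve_left hlam.ne'
  obtain ⟨ρ, hρ, hball⟩ := Metric.eventually_nhds_iff_ball.1 (hmin.and (hUo.mem_nhds hq))
  have hz := hopf (u := u) (q := q) (ρ := ρ) (fun z hz => hu z (hball z hz).2)
    (fun z hz => by have := (hball z hz).1; rwa [huq] at this)
    (fun z hz => by
      have h1 := (hball z hz).1
      rw [huq] at h1
      have := heq z (hball z hz).2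
      nlinarith) huq
  obtain ⟨z, hzU, hzne⟩ := hne
  apply hzne
  refine hu.eqOn_zero_of_preconnected_of_eventuallyEq_zero hUconn.isPreconnected hq ?_ hzU
  filter_upwards [ball_mem_nhds q (show 0 < ρ / 4 by linarith)] with w hw
  exact hz w hw

theorem loj_one_dim {g : ℝ → ℝ} (hg : AnalyticAt ℝ g 0) (hd : deriv g 0 = 0) :
    ∃ n : ℕ, 2 ≤ n ∧ ∃ C > 0, ∀ᶠ x in 𝓝 (0 : ℝ), |g x - g 0| ^ (n - 1) ≤ C * |deriv g x| ^ n := by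
  have hg0 : AnalyticAt ℝ (fun x => g x - g 0) 0 := hg.sub analyticAt_const
  by_cases hz : ∀ᶠ x in 𝓝 (0 : ℝ), g x - g 0 = 0
  · refine ⟨2, le_rfl, 1, one_pos, ?_⟩
    filter_upwards [hz] with x hx
    rw [hx]; simp; positivity
  obtain ⟨k, w, hw, hw0, hwk⟩ := hg0.exists_eventuallyEq_pow_smul_nonzero_iff.2 hz
  have hk1 : k ≠ 0 := by
    rintro rfl
    have := hwk.self_of_nhds
    simp at this
    exact hw0 this.symm
  have hge : g =ᶠ[𝓝 0] fun x => x ^ k * w x + g 0 := by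
    filter_upwards [hwk] with x hx
    simp at hx
    linarith
  have hder : ∀ᶠ x in 𝓝 (0 : ℝ), deriv g x = x ^ (k - 1) * (k * w x + x * deriv w x) := by
    filter_upwards [hge.eventuallyEq_nhds, hw.eventually_analyticAt] with x h1 h2
    rw [h1.deriv_eq]
    have h3 := ((hasDerivAt_pow k x).mul h2.differentiableAt.hasDerivAt).add_const (g 0)
    have h4 : deriv (fun x => x ^ k * w x + g 0) x = _ := h3.deriv
    rw [h4]
    obtain ⟨m, rfl⟩ := Nat.exists_eq_succ_of_ne_zero hk1
    simp [pow_succ]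
    ring
  have hk2 : 2 ≤ k := by
    by_contra! hlt
    have : k = 1 := by omega
    subst this
    have := hder.self_of_nhds
    rw [hd] at this
    simp at this
    exact hw0 this.symm
  have hk0 : (0 : ℝ) < k := by exact_mod_cast (by omega : 0 < k)
  set c := |w 0| / 2 with hc
  have hc0 : 0 < c := by have := abs_pos.2 hw0; positivity
  have hcont : ContinuousAt (fun x => |k * w x + x * deriv w x|) 0 := by
    have h1 := hw.continuousAt
    have h2 := hw.deriv.continuousAt
    fun_prop
  have hlow : ∀ᶠ x in 𝓝 (0 : ℝ), c < |k * w x + x * deriv w x| := by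
    refine hcont.eventually_const_lt ?_
    simp only [zero_mul, add_zero, abs_mul, Nat.abs_cast]
    have h1 : (1 : ℝ) ≤ k := by exact_mod_cast (by omega : 1 ≤ k)
    have := abs_pos.2 hw0
    nlinarith
  have hup : ∀ᶠ x in 𝓝 (0 : ℝ), |w x| < |w 0| + 1 :=
    hw.continuousAt.abs.eventually_lt_const (by simp)
  refine ⟨k, hk2, (|w 0| + 1) ^ (k - 1) / c ^ k, by positivity, ?_⟩
  filter_upwards [hge, hder, hlow, hup] with x h1 h2 h3 h4
  rw [h1, h2, add_sub_cancel_right, abs_mul, abs_mul, abs_pow, abs_pow, mul_pow, mul_pow]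
  have e1 : (|x| ^ k) ^ (k - 1) = (|x| ^ (k - 1)) ^ k := by rw [← pow_mul, ← pow_mul, mul_comm]
  rw [e1]
  calc (|x| ^ (k - 1)) ^ k * |w x| ^ (k - 1) ≤ (|x| ^ (k - 1)) ^ k * (|w 0| + 1) ^ (k - 1) := by
        gcongr
    _ = (|w 0| + 1) ^ (k - 1) / c ^ k * ((|x| ^ (k - 1)) ^ k * c ^ k) := by field_simp
    _ ≤ _ := by gcongr

theorem fiber_bounds {V A A' Bf B' : ℝ → ℝ} {r κ B : ℝ} (hκ : 0 < κ)
    (hV : ∀ y ∈ Ioo (-r) r, HasDerivAt V (A y) y)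
    (hA : ∀ y ∈ Ioo (-r) r, HasDerivAt A (A' y) y)
    (hB : ∀ y ∈ Ioo (-r) r, HasDerivAt Bf (B' y) y)
    (hA1 : ∀ y ∈ Ioo (-r) r, κ / 2 ≤ A' y) (hA2 : ∀ y ∈ Ioo (-r) r, A' y ≤ 2 * κ)
    (hB1 : ∀ y ∈ Ioo (-r) r, |B' y| ≤ B) {h y : ℝ} (hh : h ∈ Ioo (-r) r) (hy : y ∈ Ioo (-r) r)
    (hAh : A h = 0) :
    κ / 2 * |y - h| ≤ |A y| ∧ |Bf y - Bf h| ≤ B * |y - h| ∧ |V y - V h| ≤ 2 * κ * |y - h| ^ 2 := by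
  have hAup : ∀ s ∈ Ioo (-r) r, |A s| ≤ 2 * κ * |s - h| := by
    intro s hs
    have := (convex_Ioo (-r) r).norm_image_sub_le_of_norm_hasDerivWithin_le (f := A) (f' := A')
      (C := 2 * κ) (fun x hx => (hA x hx).hasDerivWithinAt)
      (fun x hx => by
        rw [Real.norm_eq_abs, abs_le]; exact ⟨by linarith [hA1 x hx], hA2 x hx⟩) hh hs
    simpa [hAh] using this
  refine ⟨?_, ?_, ?_⟩
  · have hmono : ∀ a ∈ Ioo (-r) r, ∀ b ∈ Ioo (-r) r, a ≤ b → κ / 2 * (b - a) ≤ A b - A a := by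
      refine (convex_Ioo (-r) r).mul_sub_le_image_sub_of_le_deriv
        (fun x hx => (hA x hx).continuousAt.continuousWithinAt) ?_ ?_
      · rw [interior_Ioo]
        exact fun x hx => (hA x hx).differentiableAt.differentiableWithinAt
      · rw [interior_Ioo]
        intro x hx
        rw [(hA x hx).deriv]; exact hA1 x hx
    rcases le_total h y with h1 | h1
    · have := hmono h hh y hy h1
      rw [abs_of_nonneg (sub_nonneg.2 h1)]
      linarith [le_abs_self (A y)]
    · have := hmono y hy h hh h1
      rw [abs_of_nonpos (sub_nonpos.2 h1)]
      linarith [neg_le_abs (A y)]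
  · exact (convex_Ioo (-r) r).norm_image_sub_le_of_norm_hasDerivWithin_le (f := Bf) (f' := B')
      (fun x hx => (hB x hx).hasDerivWithinAt) hB1 hh hy
  · have hsub : uIcc h y ⊆ Ioo (-r) r := (convex_Ioo (-r) r).ordConnected.uIcc_subset hh hy
    have := (convex_uIcc h y).norm_image_sub_le_of_norm_hasDerivWithin_le (f := V) (f' := A)
      (C := 2 * κ * |y - h|) (fun x hx => (hV x (hsub hx)).hasDerivWithinAt)
      (fun x hx => by
        refine (hAup x (hsub hx)).trans ?_
        have : |x - h| ≤ |y - h| := abs_sub_left_of_mem_uIcc hx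
        gcongr) left_mem_uIcc right_mem_uIcc
    calc |V y - V h| ≤ 2 * κ * |y - h| * |y - h| := this
      _ = _ := by ring

theorem loj_arith {n : ℕ} (hn : 2 ≤ n) {f g d G g' b a C₁ κ B : ℝ} (hC₁ : 0 < C₁) (hκ : 0 < κ)
    (hB : 0 ≤ B) (hf : 0 ≤ f) (hG : 0 ≤ G) (hd : 0 ≤ d) (hd1 : d ≤ 1)
    (hfg : f ≤ |g| + 2 * κ * d ^ 2) (hg : |g| ^ (n - 1) ≤ C₁ * |g'| ^ n)
    (hg' : |b - g'| ≤ B * d) (ha : κ / 2 * d ≤ |a|) (haG : |a| ≤ G) (hbG : |b| ≤ G) :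
    f ^ (n - 1) ≤ (2 ^ (n - 1 - 1) * (C₁ * (1 + B * (2 / κ)) ^ n
      + (2 * κ) ^ (n - 1) * (2 / κ) ^ n)) * G ^ n := by
  have hdG : d ≤ 2 / κ * G := by
    rw [div_mul_eq_mul_div, le_div_iff₀ hκ]; linarith
  have hg'G : |g'| ≤ (1 + B * (2 / κ)) * G := by
    have h1 := abs_sub_abs_le_abs_sub g' b
    rw [abs_sub_comm] at h1
    have h2 : B * d ≤ B * (2 / κ * G) := by gcongr
    linarith
  have hdn : (d ^ 2) ^ (n - 1) ≤ d ^ n := by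
    rw [← pow_mul]
    exact pow_le_pow_of_le_one hd hd1 (by omega)
  calc f ^ (n - 1) ≤ (|g| + 2 * κ * d ^ 2) ^ (n - 1) := by gcongr
    _ ≤ 2 ^ (n - 1 - 1) * (|g| ^ (n - 1) + (2 * κ * d ^ 2) ^ (n - 1)) :=
        add_pow_le (abs_nonneg _) (by positivity) _
    _ = 2 ^ (n - 1 - 1) * (|g| ^ (n - 1) + (2 * κ) ^ (n - 1) * (d ^ 2) ^ (n - 1)) := by
        rw [mul_pow (2 * κ)]
    _ ≤ 2 ^ (n - 1 - 1) * (C₁ * ((1 + B * (2 / κ)) * G) ^ n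
          + (2 * κ) ^ (n - 1) * (2 / κ * G) ^ n) := by
        have h1 : |g| ^ (n - 1) ≤ C₁ * ((1 + B * (2 / κ)) * G) ^ n := by
          refine hg.trans ?_
          gcongr
        have h2 : (d ^ 2) ^ (n - 1) ≤ (2 / κ * G) ^ n := by
          refine hdn.trans ?_
          gcongr
        gcongr
    _ = _ := by rw [mul_pow, mul_pow]; ring

theorem abs_fderiv_le_gradient {u : E2 → ℝ} (z : E2) {e : E2} (he : ‖e‖ = 1) :
    |fderiv ℝ u z e| ≤ ‖gradient u z‖ := by
  have h1 : ‖gradient u z‖ = ‖fderiv ℝ u z‖ := by simp [gradient]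
  rw [h1]
  have := (fderiv ℝ u z).le_opNorm e
  rwa [he, mul_one] at this

theorem omega_iff_analyticAt {E F : Type*} [NormedAddCommGroup E] [NormedSpace ℝ E]
    [NormedAddCommGroup F] [NormedSpace ℝ F] [CompleteSpace F] {f : E → F} {x : E} :
    ContDiffAt ℝ (⊤ : WithTop ℕ∞) f x ↔ AnalyticAt ℝ f x := by
  rw [← contDiffWithinAt_univ, ← analyticWithinAt_univ]
  exact contDiffWithinAt_omega_iff_analyticWithinAt

theorem implicit_one {F : ℝ × ℝ → ℝ} (hF : AnalyticAt ℝ F 0) (h0 : F 0 = 0)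
    (hd : fderiv ℝ F 0 (0, 1) ≠ 0) :
    ∃ h : ℝ → ℝ, AnalyticAt ℝ h 0 ∧ h 0 = 0 ∧ ∀ᶠ x in 𝓝 (0 : ℝ), F (x, h x) = 0 := by
  have cdf : ContDiffAt ℝ (⊤ : WithTop ℕ∞) F 0 := omega_iff_analyticAt.2 hF
  have pn : (⊤ : WithTop ℕ∞) ≠ 0 := by simp
  have if2 : (fderiv ℝ F 0 ∘L .inr ℝ ℝ ℝ).IsInvertible := by
    refine ⟨ContinuousLinearEquiv.unitsEquivAut ℝ (Units.mk0 _ hd), ?_⟩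
    ext
    simp
  refine ⟨cdf.implicitFunction pn if2, ?_, ?_, ?_⟩
  · exact omega_iff_analyticAt.1 (cdf.contDiffAt_implicitFunction pn if2)
  · exact cdf.implicitFunction_apply_self pn if2
  · have := cdf.eventually_apply_implicitFunction pn if2
    rw [h0] at this
    exact this

theorem lojasiewicz {u : E2 → ℝ} {q : E2} (hu : AnalyticAt ℝ u q) (hmin : IsLocalMin u q)
    (hl : 0 < lap u q) :
    ∃ n : ℕ, 2 ≤ n ∧ ∃ C > 0, ∀ᶠ z in 𝓝 q, (u z - u q) ^ (n - 1) ≤ C * ‖gradient u z‖ ^ n := by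
  obtain ⟨i, -, hi⟩ := Finset.exists_lt_of_sum_lt (s := Finset.univ) (f := fun _ : Fin 2 => (0 : ℝ))
    (g := fun i => iteratedFDeriv ℝ 2 u q (fun _ => EuclideanSpace.single i 1))
    (by simpa [lap] using hl)
  obtain ⟨j, hij⟩ : ∃ j : Fin 2, j ≠ i := exists_ne i
  set e : E2 := EuclideanSpace.single i 1 with he
  set e' : E2 := EuclideanSpace.single j 1 with he'
  have hne : ‖e‖ = 1 := by simp [he]
  have hne' : ‖e'‖ = 1 := by simp [he']
  rw [iteratedFDeriv_two_apply] at hi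
  set κ := fderiv ℝ (fderiv ℝ u) q e e with hκdef
  have hκ : 0 < κ := hi
  set P : ℝ × ℝ → E2 := fun v => q + v.1 • e' + v.2 • e with hP
  have hP0 : P 0 = q := by simp [hP]
  have hPan : ∀ v, AnalyticAt ℝ P v := by
    intro v
    have : ContDiffAt ℝ (⊤ : WithTop ℕ∞) P v := by
      have : ContDiff ℝ (⊤ : WithTop ℕ∞) P := by fun_prop
      exact this.contDiffAt
    exact omega_iff_analyticAt.1 this
  have hPe : ∀ x y, HasDerivAt (fun y => P (x, y)) e y := fun x y =>
    hasDerivAt_line (q + x • e') e y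
  have hAd : AnalyticAt ℝ (fun z => fderiv ℝ u z e) q :=
    ((ContinuousLinearMap.apply ℝ ℝ e).analyticAt _).comp hu.fderiv
  have hgrad0 : fderiv ℝ u q = 0 := hmin.fderiv_eq_zero
  -- general derivative of partial derivative
  have hpart : ∀ z, AnalyticAt ℝ u z → ∀ c : E2, HasFDerivAt (fun w => fderiv ℝ u w c)
      ((ContinuousLinearMap.apply ℝ ℝ c).comp (fderiv ℝ (fderiv ℝ u) z)) z := fun z hz c =>
    (ContinuousLinearMap.apply ℝ ℝ c).hasFDerivAt.comp z hz.fderiv.differentiableAt.hasFDerivAt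
  have hpd : ∀ x y, AnalyticAt ℝ u (P (x, y)) → ∀ c : E2,
      HasDerivAt (fun y => fderiv ℝ u (P (x, y)) c) (fderiv ℝ (fderiv ℝ u) (P (x, y)) e c) y :=
    fun x y hz c => HasFDerivAt.comp_hasDerivAt (f := fun y => P (x, y)) y
      (hpart (P (x, y)) hz c) (hPe x y)
  have hFan : AnalyticAt ℝ (fun v => fderiv ℝ u (P v) e) 0 :=
    AnalyticAt.comp_of_eq hAd (hPan 0) hP0
  obtain ⟨h, han, hh0, hhF⟩ := implicit_one hFan (by rw [hP0, hgrad0]; rfl) (by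
    have h1 : HasDerivAt (fun y : ℝ => fderiv ℝ u (P (0, y)) e) κ 0 :=
      (hpart q hu e).comp_hasDerivAt_of_eq (0 : ℝ) (hPe 0 0) (by simp [hP])
    have h3 : HasDerivAt (fun y : ℝ => ((0 : ℝ), y)) (0, 1) 0 :=
      (hasDerivAt_const _ _).prodMk (hasDerivAt_id _)
    have h2 : HasDerivAt (fun y : ℝ => fderiv ℝ u (P (0, y)) e)
      (fderiv ℝ (fun v => fderiv ℝ u (P v) e) 0 (0, 1)) 0 :=
      hFan.differentiableAt.hasFDerivAt.comp_hasDerivAt_of_eq (0 : ℝ) h3 rfl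
    rw [h2.unique h1]
    exact hκ.ne')
  have hγan : AnalyticAt ℝ (fun x : ℝ => P (x, h x)) 0 :=
    (hPan _).comp_of_eq (analyticAt_id.prod han) rfl
  have hγ0 : P ((0 : ℝ), h 0) = q := by rw [hh0]; exact hP0
  set g : ℝ → ℝ := fun x => u (P (x, h x)) with hg
  have hgan : AnalyticAt ℝ g 0 := AnalyticAt.comp_of_eq hu hγan hγ0
  have hg0 : g 0 = u q := by simp only [hg]; rw [hγ0]
  have hγt : Tendsto (fun x : ℝ => P (x, h x)) (𝓝 0) (𝓝 q) := by
    have := hγan.continuousAt.tendsto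
    rwa [hγ0] at this
  have hgd : ∀ᶠ x in 𝓝 (0 : ℝ), deriv g x = fderiv ℝ u (P (x, h x)) e' := by
    filter_upwards [hhF, han.eventually_analyticAt, hγt.eventually hu.eventually_analyticAt]
      with x h1 h2 h3
    have h4 : HasDerivAt (fun x => P (x, h x)) (e' + deriv h x • e) x :=
      (hasDerivAt_line q e' x).add (h2.differentiableAt.hasDerivAt.smul_const e)
    have h5 : HasDerivAt g _ x := h3.differentiableAt.hasFDerivAt.comp_hasDerivAt x h4
    rw [h5.deriv, map_add, map_smul, h1, smul_zero, add_zero]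
  have hgd0 : deriv g 0 = 0 := by
    rw [hgd.self_of_nhds, hγ0, hgrad0]; rfl
  obtain ⟨n, hn, C₁, hC₁, hloj⟩ := loj_one_dim hgan hgd0
  -- the good ball
  set B := |fderiv ℝ (fderiv ℝ u) q e e'| + 1 with hB
  have hc1 : ContinuousAt (fun z => fderiv ℝ (fderiv ℝ u) z e e) q :=
    (hu.fderiv.fderiv.continuousAt.clm_apply continuousAt_const).clm_apply continuousAt_const
  have hc2 : ContinuousAt (fun z => |fderiv ℝ (fderiv ℝ u) z e e'|) q :=
    ((hu.fderiv.fderiv.continuousAt.clm_apply continuousAt_const).clm_apply continuousAt_const).abs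
  have hball : ∀ᶠ z in 𝓝 q, AnalyticAt ℝ u z ∧ κ / 2 < fderiv ℝ (fderiv ℝ u) z e e ∧
      fderiv ℝ (fderiv ℝ u) z e e < 2 * κ ∧ |fderiv ℝ (fderiv ℝ u) z e e'| < B ∧ u q ≤ u z := by
    filter_upwards [hu.eventually_analyticAt, hc1.eventually_const_lt (half_lt_self hκ),
      hc1.eventually_lt_const (by linarith : κ < 2 * κ), hc2.eventually_lt_const (lt_add_one _), hmin]
      with z h1 h2 h3 h4 h5
    exact ⟨h1, h2, h3, h4, h5⟩
  obtain ⟨ρ, hρ, hρb⟩ := Metric.eventually_nhds_iff_ball.1 hball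
  set r := min (ρ / 2) (1 / 2) with hr
  have hr0 : 0 < r := by positivity
  have hr1 : r ≤ ρ / 2 := min_le_left _ _
  have hr2 : r ≤ 1 / 2 := min_le_right _ _
  have hPb : ∀ x ∈ Ioo (-r) r, ∀ y ∈ Ioo (-r) r, P (x, y) ∈ ball q ρ := by
    intro x hx y hy
    rw [mem_ball_iff_norm]
    have : P (x, y) - q = x • e' + y • e := by simp only [hP]; abel
    rw [this]
    refine (norm_add_le _ _).trans_lt ?_
    rw [norm_smul, norm_smul, hne, hne', Real.norm_eq_abs, Real.norm_eq_abs]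
    have h1 := abs_lt.2 hx
    have h2 := abs_lt.2 hy
    linarith
  have hnear : ∀ᶠ x in 𝓝 (0 : ℝ), h x ∈ Ioo (-r) r := by
    refine han.continuousAt.eventually_mem ?_
    rw [hh0]; exact Ioo_mem_nhds (by linarith) hr0
  have hall : ∀ᶠ x in 𝓝 (0 : ℝ), ∀ y ∈ Ioo (-r) r, (u (P (x, y)) - u q) ^ (n - 1) ≤
      (2 ^ (n - 1 - 1) * (C₁ * (1 + B * (2 / κ)) ^ n
      + (2 * κ) ^ (n - 1) * (2 / κ) ^ n)) * ‖gradient u (P (x, y))‖ ^ n := by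
    filter_upwards [hnear, hloj, hgd, hhF, Ioo_mem_nhds (by linarith : -r < 0) hr0]
      with x h1 h2 h3 h4 h5 y hy
    obtain ⟨f1, f2, f3⟩ := fiber_bounds (V := fun y => u (P (x, y)))
      (A := fun y => fderiv ℝ u (P (x, y)) e) (A' := fun y => fderiv ℝ (fderiv ℝ u) (P (x, y)) e e)
      (Bf := fun y => fderiv ℝ u (P (x, y)) e')
      (B' := fun y => fderiv ℝ (fderiv ℝ u) (P (x, y)) e e') (r := r) (B := B) hκ
      (fun y hy => (hρb _ (hPb x h5 y hy)).1.differentiableAt.hasFDerivAt.comp_hasDerivAt y (hPe x y))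
      (fun y hy => hpd x y (hρb _ (hPb x h5 y hy)).1 e)
      (fun y hy => hpd x y (hρb _ (hPb x h5 y hy)).1 e')
      (fun y hy => (hρb _ (hPb x h5 y hy)).2.1.le)
      (fun y hy => (hρb _ (hPb x h5 y hy)).2.2.1.le)
      (fun y hy => (hρb _ (hPb x h5 y hy)).2.2.2.1.le) h1 hy h4
    have hq := (hρb _ (hPb x h5 y hy)).2.2.2.2
    refine loj_arith hn (d := |y - h x|) (g := g x - g 0) (g' := deriv g x)
      (b := fderiv ℝ u (P (x, y)) e') (a := fderiv ℝ u (P (x, y)) e) hC₁ hκ (by positivity)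
      (by linarith) (norm_nonneg _) (abs_nonneg _) ?_ ?_ h2 ?_ f1
      (abs_fderiv_le_gradient _ hne) (abs_fderiv_le_gradient _ hne')
    · rw [abs_le]
      constructor <;> linarith [hy.1, hy.2, h1.1, h1.2]
    · have k1 := le_abs_self (u (P (x, y)) - u (P (x, h x)))
      have k2 := le_abs_self (g x - g 0)
      rw [hg0] at k2 ⊢
      simp only [hg] at k2 ⊢
      linarith
    · rw [h3]; exact f2
  refine ⟨n, hn, (2 ^ (n - 1 - 1) * (C₁ * (1 + B * (2 / κ)) ^ n
      + (2 * κ) ^ (n - 1) * (2 / κ) ^ n)), by positivity, ?_⟩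
  have t1 : Tendsto (fun z : E2 => z j - q j) (𝓝 q) (𝓝 0) := by
    have : Continuous (fun z : E2 => z j - q j) := by fun_prop
    simpa using this.tendsto q
  have t2 : Tendsto (fun z : E2 => z i - q i) (𝓝 q) (𝓝 0) := by
    have : Continuous (fun z : E2 => z i - q i) := by fun_prop
    simpa using this.tendsto q
  filter_upwards [t1.eventually hall, t2.eventually (Ioo_mem_nhds (by linarith : -r < 0) hr0)]
    with z h1 h2
  have h3 := h1 _ h2
  have h4 : P (z j - q j, z i - q i) = z := by
    ext k
    simp only [hP, he, he', PiLp.add_apply, PiLp.smul_apply, PiLp.single_apply, smul_eq_mul]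
    by_cases hk : k = i
    · subst hk; simp [hij.symm]
    · have : k = j := by omega
      subst this; simp [hij]
  rwa [h4] at h3

theorem stay {Ω : Set E2} (hΩo : IsOpen Ω) {u : E2 → ℝ}
    (hinv : ∀ γ : ℝ → E2, (∀ t : ℝ, HasDerivAt γ (-(gradient u (γ t))) t) →
      γ 0 ∈ frontier Ω → ∀ t : ℝ, γ t ∈ frontier Ω)
    {γ : ℝ → E2} (hγ : ∀ t : ℝ, HasDerivAt γ (-(gradient u (γ t))) t) (h0 : γ 0 ∈ Ω) (t : ℝ) :
    γ t ∈ Ω := by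
  by_contra hn
  have hc : Continuous γ := continuous_iff_continuousAt.2 fun t => (hγ t).continuousAt
  have hpre : IsPreconnected (range γ) := isPreconnected_range hc
  have hfr : (range γ ∩ frontier Ω).Nonempty := by
    by_contra hemp
    rw [not_nonempty_iff_eq_empty] at hemp
    have hcl : closure Ω \ Ω = frontier Ω := by rw [frontier, hΩo.interior_eq]
    have hsub : range γ ⊆ Ω ∪ (closure Ω)ᶜ := by
      intro x hx
      by_contra hx'
      have : x ∈ range γ ∩ frontier Ω := by
        refine ⟨hx, ?_⟩
        rw [← hcl]
        simp only [mem_union, mem_compl_iff, not_or, not_not] at hx'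
        exact ⟨hx'.2, hx'.1⟩
      rw [hemp] at this
      exact this
    obtain ⟨x, -, hx1, hx2⟩ := hpre Ω (closure Ω)ᶜ hΩo isClosed_closure.isOpen_compl hsub
      ⟨γ 0, ⟨0, rfl⟩, h0⟩ ⟨γ t, ⟨t, rfl⟩, by
        rcases hsub ⟨t, rfl⟩ with h | h
        · exact absurd h hn
        · exact h⟩
    exact hx2 (subset_closure hx1)
  obtain ⟨_, ⟨s, rfl⟩, hs⟩ := hfr
  have h1 : ∀ t, HasDerivAt (fun r => γ (r + s)) (-(gradient u (γ (t + s)))) t :=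
    fun t => (hγ (t + s)).comp_add_const t s
  have h2 := hinv _ h1 (by simpa using hs) (-s)
  simp only [neg_add_cancel] at h2
  rw [frontier, hΩo.interior_eq] at h2
  exact h2.2 h0

theorem cutoff {Kc U : Set E2} (hK : IsCompact Kc) (hUo : IsOpen U) (hKU : Kc ⊆ U) {u : E2 → ℝ}
    (hu : AnalyticOnNhd ℝ u U) :
    ∃ (X : E2 → E2) (K M : NNReal) (O : Set E2), LipschitzWith K X ∧ (∀ x, ‖X x‖ ≤ M) ∧
      IsOpen O ∧ Kc ⊆ O ∧ O ⊆ U ∧ ∀ z ∈ O, X z = -gradient u z := by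
  obtain ⟨L, hL, hKL, hLU⟩ := exists_compact_between hK hUo hKU
  obtain ⟨f, hf1, hf0, -⟩ := exists_contMDiffMap_one_nhds_of_subset_interior
    (n := (1 : ℕ∞)) (modelWithCornersSelf ℝ E2) hK.isClosed hKL
  have hfc : ContDiff ℝ 1 f := f.contMDiff.contDiff
  obtain ⟨O₁, hO₁, hKO₁, hO₁f⟩ := eventually_nhdsSet_iff_exists.1 hf1
  set X : E2 → E2 := fun z => f z • (-gradient u z) with hX
  have hsupp : HasCompactSupport X := by
    refine HasCompactSupport.intro hL fun x hx => ?_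
    simp [hX, hf0 x hx]
  have hXc : ContDiff ℝ 1 X := by
    rw [contDiff_iff_contDiffAt]
    intro z
    by_cases hz : z ∈ L
    · have h1 : ContDiffAt ℝ 1 (fderiv ℝ u) z := (hu z (hLU hz)).fderiv.contDiffAt
      have h2 : ContDiffAt ℝ 1 (gradient u) z :=
        (InnerProductSpace.toDual ℝ E2).symm.contDiff.contDiffAt.comp z h1
      exact hfc.contDiffAt.smul h2.neg
    · have : X =ᶠ[𝓝 z] fun _ => 0 := by
        filter_upwards [hL.isClosed.isOpen_compl.mem_nhds hz] with w hw
        simp [hX, hf0 w hw]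
      exact contDiffAt_const.congr_of_eventuallyEq this
  obtain ⟨K, hKl⟩ := hXc.lipschitzWith_of_hasCompactSupport hsupp one_ne_zero
  obtain ⟨M, hM⟩ := hsupp.exists_bound_of_continuous hXc.continuous
  refine ⟨X, K, M.toNNReal, O₁ ∩ U, hKl, fun x => (hM x).trans (Real.le_coe_toNNReal M),
    hO₁.inter hUo, subset_inter hKO₁ hKU, inter_subset_right, fun z hz => ?_⟩
  simp [hX, hO₁f z hz.1]

theorem attract {U O : Set E2} (hUo : IsOpen U) (hUconn : IsConnected U) {lam : ℝ} (hlam : 0 < lam)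
    {u : E2 → ℝ} (hu : AnalyticOnNhd ℝ u U) (hne : ∃ z ∈ U, u z ≠ 0)
    (heq : ∀ z ∈ U, lap u z + lam * u z = 0) (hO : IsOpen O) (hOU : O ⊆ U)
    {X : E2 → E2} {K : NNReal} (hX : LipschitzWith K X) (hXu : ∀ z ∈ O, X z = -gradient u z)
    {q : E2} (hq : q ∈ O) (hmin : IsLocalMin u q) :
    ∃ δ > 0, ∀ γ : ℝ → E2, (∀ t, HasDerivAt γ (X (γ t)) t) → ∀ T, γ T ∈ ball q δ →
      (∀ t ≥ T, γ t ∈ O) ∧ ∃ p, IsLocalMin u p ∧ Tendsto γ atTop (𝓝 p) := by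
  have hl := lap_pos_of_isLocalMin hUo hUconn hlam hu hne heq (hOU hq) hmin
  obtain ⟨n, hn, C, hC, hL⟩ := lojasiewicz (hu q (hOU hq)) hmin hl
  have hev : ∀ᶠ z in 𝓝 q, z ∈ O ∧ u q ≤ u z ∧
      (u z - u q) ^ (n - 1) ≤ C * ‖gradient u z‖ ^ n := by
    filter_upwards [hO.mem_nhds hq, hmin, hL] with z h1 h2 h3
    exact ⟨h1, h2, h3⟩
  obtain ⟨ε, hε, hb⟩ := Metric.eventually_nhds_iff_ball.1 hev
  obtain ⟨δ, hδ, hst⟩ := stability hε hX (fun z hz => hXu z (hb z hz).1)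
    (fun z hz => (hu z (hOU (hb z hz).1)).differentiableAt) (fun z hz => (hb z hz).2.1) hn hC
    (fun z hz => (hb z hz).2.2)
  refine ⟨δ, hδ, fun γ hγ T hT => ?_⟩
  obtain ⟨h1, h2⟩ := hst γ hγ T hT
  exact ⟨fun t ht => (hb _ (h1 t ht)).1, h2⟩

theorem lap_neg (u : E2 → ℝ) (z : E2) : lap (-u) z = -lap u z := by
  simp [lap, iteratedFDeriv_neg_apply]

theorem gradient_neg_apply (u : E2 → ℝ) (z : E2) : gradient (-u) z = -gradient u z := by
  rw [gradient, gradient, fderiv_neg, map_neg]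

/-- The set `W` is open. -/
theorem Wset_isOpen
    (Ω U : Set E2) (hΩne : Ω.Nonempty) (hΩo : IsOpen Ω)
    (hΩb : Bornology.IsBounded Ω)
    (hUo : IsOpen U) (hUconn : IsConnected U) (hsub : closure Ω ⊆ U)
    (lam : ℝ) (hlam : 0 < lam)
    (u : E2 → ℝ) (hu : AnalyticOnNhd ℝ u U)
    (hne : ∃ z ∈ U, u z ≠ 0)
    (heq : ∀ z ∈ U, lap u z + lam * u z = 0)
    (hinv : ∀ γ : ℝ → E2, (∀ t : ℝ, HasDerivAt γ (-(gradient u (γ t))) t) →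
      γ 0 ∈ frontier Ω → ∀ t : ℝ, γ t ∈ frontier Ω) :
    IsOpen (Wset Ω u) := by
  obtain ⟨X, K, M, O, hX, hM, hO, hΩO, hOU, hXu⟩ :=
    cutoff hΩb.isCompact_closure hUo hsub hu
  rw [Metric.isOpen_iff]
  rintro z ⟨hzΩ, γ, hγ0, hγ, hγcl, ⟨q, hq, hqmin, hγq⟩, ⟨p, hp, hpmax, hγp⟩⟩
  have hγΩ : ∀ t, γ t ∈ Ω := stay hΩo hinv hγ (hγ0 ▸ hzΩ)
  have hγX : ∀ t, HasDerivAt γ (X (γ t)) t := fun t => by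
    rw [hXu _ (hΩO (hγcl t))]; exact hγ t
  obtain ⟨δ, hδ, hatt⟩ := attract hUo hUconn hlam hu hne heq hO hOU hX hXu (hΩO hq) hqmin
  obtain ⟨δ', hδ', hatt'⟩ := attract (u := -u) (X := -X) (K := K) (q := p) hUo hUconn hlam hu.neg
    (by obtain ⟨w, hw, hw0⟩ := hne; exact ⟨w, hw, by simpa using hw0⟩)
    (fun w hw => by
      have := heq w hw
      rw [lap_neg, Pi.neg_apply]; linarith)
    hO hOU hX.neg
    (fun w hw => by rw [Pi.neg_apply, hXu w hw, gradient_neg_apply]) (hΩO hp) hpmax.neg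
  obtain ⟨T₁, hT₁⟩ := eventually_atTop.1 (hγq.eventually (ball_mem_nhds q (half_pos hδ)))
  obtain ⟨T₂, hT₂⟩ := eventually_atBot.1 (hγp.eventually (ball_mem_nhds p (half_pos hδ')))
  set T := max 0 (max T₁ (-T₂)) with hT
  have hT0 : 0 ≤ T := le_max_left _ _
  have hTq : dist (γ T) q < δ / 2 := hT₁ T ((le_max_left _ _).trans (le_max_right _ _))
  have hTp : dist (γ (-T)) p < δ' / 2 := hT₂ (-T) (by
    have : -T₂ ≤ T := (le_max_right _ _).trans (le_max_right _ _)
    linarith)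
  have hc : Continuous γ := continuous_iff_continuousAt.2 fun t => (hγ t).continuousAt
  obtain ⟨η, hη, hηΩ⟩ := (isCompact_Icc.image hc : IsCompact (γ '' Icc (-T) T)).exists_thickening_subset_open
    hΩo (by rintro _ ⟨t, -, rfl⟩; exact hγΩ t)
  set ε := min (min (δ / 2) (δ' / 2)) η with hε
  have hε0 : 0 < ε := by positivity
  refine ⟨ε * Real.exp (-(K * T)), by positivity, fun z' hz' => ?_⟩
  obtain ⟨γ', hγ'0, hγ'⟩ := ode_global_exists hX hM z'
  have hclose : ∀ t, |t| ≤ T → dist (γ' t) (γ t) < ε := by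
    intro t ht
    refine (ode_dist hX hγ' hγX ht).trans_lt ?_
    rw [hγ'0, hγ0]
    calc dist z' z * Real.exp (K * T) < ε * Real.exp (-(K * T)) * Real.exp (K * T) := by
          gcongr; exact hz'
      _ = ε := by rw [mul_assoc, ← Real.exp_add]; simp
  have hmid : ∀ t, |t| ≤ T → γ' t ∈ Ω := fun t ht => hηΩ (by
    rw [mem_thickening_iff]
    exact ⟨γ t, ⟨t, abs_le.1 ht, rfl⟩, (hclose t ht).trans_le (min_le_right _ _)⟩)
  obtain ⟨hfO, q', hq'min, hq'⟩ := hatt γ' hγ' T (by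
    have h1 := hclose T (abs_of_nonneg hT0).le
    have h2 : ε ≤ δ / 2 := (min_le_left _ _).trans (min_le_left _ _)
    have h3 := dist_triangle (γ' T) (γ T) q
    rw [mem_ball]; linarith)
  obtain ⟨hbO, p', hp'max, hp'⟩ := hatt' (fun s => γ' (-s)) (ode_reverse hγ') T (by
    have h1 := hclose (-T) (by rw [abs_neg]; exact (abs_of_nonneg hT0).le)
    have h2 : ε ≤ δ' / 2 := (min_le_left _ _).trans (min_le_right _ _)
    have h3 := dist_triangle (γ' (-T)) (γ (-T)) p
    rw [mem_ball]; linarith)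
  have hallO : ∀ t, γ' t ∈ O := by
    intro t
    rcases le_total T t with h | h
    · exact hfO t h
    rcases le_total t (-T) with h' | h'
    · have := hbO (-t) (by linarith)
      simpa using this
    · exact hΩO (subset_closure (hmid t (abs_le.2 ⟨h', h⟩)))
  have hγ'u : ∀ t, HasDerivAt γ' (-(gradient u (γ' t))) t := fun t => by
    rw [← hXu _ (hallO t)]; exact hγ' t
  have h0 : γ' 0 ∈ Ω := hmid 0 (by simpa using hT0)
  have hcl : ∀ t, γ' t ∈ closure Ω := fun t => subset_closure (stay hΩo hinv hγ'u h0 t)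
  have hbot : Tendsto γ' atBot (𝓝 p') := by
    have := hp'.comp tendsto_neg_atBot_atTop
    simpa [Function.comp_def] using this
  refine ⟨hγ'0 ▸ h0, γ', hγ'0, hγ'u, hcl,
    ⟨q', isClosed_closure.mem_of_tendsto hq' (Eventually.of_forall hcl), hq'min, hq'⟩,
    ⟨p', isClosed_closure.mem_of_tendsto hbot (Eventually.of_forall hcl), ?_, hbot⟩⟩
  simpa using hp'max.neg
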